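/- Let T_0 be the tree on 8 vertices obtained from a path a_1 a_2 a_3 a_4 a_5 by attaching one pendant leaf to each of a_2, a_3, a_4. Then T_0 admits no (1,2,2)-packing coloring. -/

import Mathlib

/-- `c` is an `s`-packing coloring of the simple graph `G`: for each color `i`, any two
distinct vertices with color `i` are at graph distance strictly greater than `s i`
(vertices in different connected components trivially satisfy this). -/
def IsPackingColoring {V : Type*} (G : SimpleGraph V) {k : ℕ} (s : Fin k → ℕ)
    (c : V → Fin k) : Prop :=
  ∀ u v : V, u ≠ v → c u = c v → G.Reachable u v → s (c u) < G.dist u v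

/-- The tree `T₀`: a path `a₁ a₂ a₃ a₄ a₅` (vertices `0,…,4`) with one pendant leaf
attached to each of `a₂, a₃, a₄` (leaves `5, 6, 7`). -/
def treeT0 : SimpleGraph (Fin 8) :=
  SimpleGraph.fromRel (fun u v =>
    (u, v) ∈ ([(0,1),(1,2),(2,3),(3,4),(1,5),(2,6),(3,7)] : List (Fin 8 × Fin 8)))

namespace IsPackingColoring

variable {V : Type*} {G : SimpleGraph V}

theorem ne_of_walk {k : ℕ} {s : Fin k → ℕ} {c : V → Fin k} (hc : IsPackingColoring G s c)
    {u v : V} (huv : u ≠ v) (p : G.Walk u v) (hp : p.length ≤ s (c u)) : c u ≠ c v :=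
  fun h => absurd (hc u v huv h p.reachable) (not_lt.2 ((SimpleGraph.dist_le p).trans hp))

theorem ne_of_adj {c : V → Fin 3} (hc : IsPackingColoring G ![1, 2, 2] c) {u v : V}
    (h : G.Adj u v) : c u ≠ c v := by
  refine hc.ne_of_walk h.ne h.toWalk ?_
  generalize c u = i
  fin_cases i <;> simp

theorem ne_of_adj_of_adj {c : V → Fin 3} (hc : IsPackingColoring G ![1, 2, 2] c) {u v w : V}
    (huw : G.Adj w u) (hwv : G.Adj w v) (huv : u ≠ v) (h0 : c u ≠ 0) : c u ≠ c v := by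
  refine hc.ne_of_walk huv (.cons huw.symm hwv.toWalk) ?_
  generalize c u = i at h0
  fin_cases i <;> simp at h0 ⊢

/-- A vertex with three distinct neighbors does not receive the color of radius `1`. -/
theorem ne_zero_of_three_neighbors {c : V → Fin 3} (hc : IsPackingColoring G ![1, 2, 2] c)
    {w x y z : V} (hx : G.Adj w x) (hy : G.Adj w y) (hz : G.Adj w z)
    (hxy : x ≠ y) (hxz : x ≠ z) (hyz : y ≠ z) : c w ≠ 0 := by
  intro h0
  have hx0 := hc.ne_of_adj hx
  have hy0 := hc.ne_of_adj hy
  have hz0 := hc.ne_of_adj hz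
  rw [h0] at hx0 hy0 hz0
  have := hc.ne_of_adj_of_adj hx hy hxy hx0.symm
  have := hc.ne_of_adj_of_adj hx hz hxz hx0.symm
  have := hc.ne_of_adj_of_adj hy hz hyz hy0.symm
  omega

end IsPackingColoring

/-- `T₀` admits no `(1,2,2)`-packing coloring. -/
theorem treeT0_not_122_colorable :
    ¬ ∃ c : Fin 8 → Fin 3, IsPackingColoring treeT0 ![1, 2, 2] c := by
  rintro ⟨c, hc⟩
  have h10 : treeT0.Adj 1 0 := by simp [treeT0]
  have h12 : treeT0.Adj 1 2 := by simp [treeT0]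
  have h15 : treeT0.Adj 1 5 := by simp [treeT0]
  have h23 : treeT0.Adj 2 3 := by simp [treeT0]
  have h26 : treeT0.Adj 2 6 := by simp [treeT0]
  have h34 : treeT0.Adj 3 4 := by simp [treeT0]
  have h37 : treeT0.Adj 3 7 := by simp [treeT0]
  have h1 := hc.ne_zero_of_three_neighbors h10 h12 h15 (by decide) (by decide) (by decide)
  have h2 := hc.ne_zero_of_three_neighbors h12.symm h23 h26 (by decide) (by decide) (by decide)
  have h3 := hc.ne_zero_of_three_neighbors h23.symm h34 h37 (by decide) (by decide) (by decide)
  have := hc.ne_of_adj h12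
  have := hc.ne_of_adj h23
  have := hc.ne_of_adj_of_adj h12.symm h23 (by decide) h1
  omega
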